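/- There exists a 6 × 3 matrix M whose entries are homogeneous linear forms in ℂ[x₀,x₁,x₂,x₃] such that for every point p ∈ ℂ⁴ ∖ {0} the complex 6 × 3 matrix M(p) obtained by evaluating the entries at p has rank 3. (Such a matrix defines an injection of vector bundles 3𝒪(−1) → 6𝒪 on P³ whose cokernel is a rank-3 vector bundle E with c₁ = 3, c₂ = 6, c₃ = 10, arising from an arithmetically Cohen–Macaulay curve of degree 6 and genus 3.) -/

import Mathlib

open MvPolynomial

/-- The product of a nonzero polynomial of degree at most `3` and a nonzero polynomial of degree
at most `2` is nonzero, in terms of coefficients. -/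
theorem eq_zero_of_cubic_mul_quadratic_coeffs_eq_zero {R : Type*} [CommRing R] [IsDomain R]
    {p : Fin 4 → R} (hp : p ≠ 0) {a b c : R}
    (h₀ : p 0 * a = 0) (h₁ : p 1 * a + p 0 * b = 0)
    (h₂ : p 2 * a + p 1 * b + p 0 * c = 0) (h₃ : p 3 * a + p 2 * b + p 1 * c = 0)
    (h₄ : p 3 * b + p 2 * c = 0) (h₅ : p 3 * c = 0) : a = 0 ∧ b = 0 ∧ c = 0 := by
  by_cases p₀ : p 0 = 0
  · by_cases p₁ : p 1 = 0
    · by_cases p₂ : p 2 = 0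
      · by_cases p₃ : p 3 = 0
        · exact absurd (by ext i; fin_cases i <;> assumption) hp
        · simp_all
      · simp_all
    · simp_all
  · simp_all

/-- The `6 × 3` Toeplitz matrix of multiplication by the generic cubic polynomial
`x₀ + x₁ t + x₂ t² + x₃ t³` on polynomials in `t` of degree at most `2`. -/
noncomputable def cubicToeplitz (R : Type*) [CommRing R] :
    Matrix (Fin 6) (Fin 3) (MvPolynomial (Fin 4) R) :=
  !![X 0, 0, 0;
     X 1, X 0, 0;
     X 2, X 1, X 0;
     X 3, X 2, X 1;
     0, X 3, X 2;
     0, 0, X 3]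

theorem cubicToeplitz_isHomogeneous (R : Type*) [CommRing R] (i : Fin 6) (j : Fin 3) :
    (cubicToeplitz R i j).IsHomogeneous 1 := by
  fin_cases i <;> fin_cases j <;>
    first
    | exact isHomogeneous_X R _
    | exact isHomogeneous_zero (Fin 4) R 1

theorem cubicToeplitz_mulVec_injective {R : Type*} [CommRing R] [IsDomain R]
    {p : Fin 4 → R} (hp : p ≠ 0) :
    Function.Injective ((cubicToeplitz R).map (eval p)).mulVec := by
  refine (injective_iff_map_eq_zero ((cubicToeplitz R).map (eval p)).mulVecLin).2 fun v hv => ?_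
  have h (i : Fin 6) := congrFun hv i
  obtain ⟨ha, hb, hc⟩ := eq_zero_of_cubic_mul_quadratic_coeffs_eq_zero hp
    (a := v 0) (b := v 1) (c := v 2)
    (by simpa [cubicToeplitz, Matrix.mulVec, dotProduct, Fin.sum_univ_three] using h 0)
    (by simpa [cubicToeplitz, Matrix.mulVec, dotProduct, Fin.sum_univ_three] using h 1)
    (by simpa [cubicToeplitz, Matrix.mulVec, dotProduct, Fin.sum_univ_three] using h 2)
    (by simpa [cubicToeplitz, Matrix.mulVec, dotProduct, Fin.sum_univ_three] using h 3)
    (by simpa [cubicToeplitz, Matrix.mulVec, dotProduct, Fin.sum_univ_three] using h 4)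
    (by simpa [cubicToeplitz, Matrix.mulVec, dotProduct, Fin.sum_univ_three] using h 5)
  ext j
  fin_cases j <;> assumption

/-- There is a `6 × 3` matrix of linear forms on `ℂ⁴` whose evaluation at every
nonzero point of `ℂ⁴` has rank `3` (defining an injection of vector bundles
`3𝒪(−1) → 6𝒪` on `P³` with rank-3 globally generated cokernel `E`,
`c₁ = 3`, `c₂ = 6`, `c₃ = 10`). -/
theorem exists_six_by_three_linear_matrix_of_full_rank :
    ∃ M : Matrix (Fin 6) (Fin 3) (MvPolynomial (Fin 4) ℂ),
      (∀ i j, (M i j).IsHomogeneous 1) ∧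
      (∀ p : Fin 4 → ℂ, p ≠ 0 → (M.map (eval p)).rank = 3) := by
  refine ⟨cubicToeplitz ℂ, cubicToeplitz_isHomogeneous ℂ, fun p hp => ?_⟩
  simpa [Matrix.rank] using LinearMap.finrank_range_of_inj
    (f := ((cubicToeplitz ℂ).map (eval p)).mulVecLin) (cubicToeplitz_mulVec_injective hp)
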